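/- Let k ≥ 2 and let β be a real number with 0 < β < 1. If n > k³(k−β)/(1−β) and c is an (n−2k+1)-coloring of the (n,k)-Kneser graph, then the number α of star-shaped color classes of c satisfies α ≥ (n/k)·β. -/

import Mathlib

open Finset in
lemma card_supersets_le (n k : ℕ) (T : Finset (Fin n)) :
    (((powersetCard k (univ : Finset (Fin n))).filter (fun S => T ⊆ S)).card) ≤
      (n - T.card).choose (k - T.card) := by
  have h : (powersetCard (k - T.card) (univ \ T)).card = (n - T.card).choose (k - T.card) := by
    rw [card_powersetCard, card_sdiff_of_subset (subset_univ _)]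
    simp
  rw [← h]
  apply card_le_card_of_injOn (fun S => S \ T)
  · intro S hS
    simp only [coe_filter, mem_powersetCard, Set.mem_ofPred_eq] at hS
    simp only [mem_coe, mem_powersetCard]
    refine ⟨sdiff_subset_sdiff (subset_univ _) (Subset.refl _), ?_⟩
    rw [card_sdiff_of_subset hS.2, hS.1.2]
  · intro S hS S' hS' hSS
    simp only [coe_filter, mem_powersetCard, Set.mem_ofPred_eq] at hS hS'
    simp only at hSS
    rw [← sdiff_union_of_subset hS.2, ← sdiff_union_of_subset hS'.2, hSS]

open Finset in
lemma star_card_le (n k : ℕ) (F : Finset (Finset (Fin n)))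
    (hF : ∀ S ∈ F, S.card = k) (i : Fin n) (hi : ∀ S ∈ F, i ∈ S) :
    F.card ≤ (n - 1).choose (k - 1) := by
  have h := card_supersets_le n k {i}
  rw [card_singleton] at h
  refine le_trans (card_le_card ?_) h
  intro S hS
  simp [mem_filter, mem_powersetCard, hF S hS, hi S hS]

open Finset in
lemma nonstar_card_le (n k : ℕ) (F : Finset (Finset (Fin n)))
    (hF : ∀ S ∈ F, S.card = k) (hI : ∀ S ∈ F, ∀ T ∈ F, ¬ Disjoint S T)
    (hi : ∀ i : Fin n, ∃ S ∈ F, i ∉ S) :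
    F.card ≤ k ^ 2 * (n - 2).choose (k - 2) := by
  rcases F.eq_empty_or_nonempty with rfl | ⟨A, hA⟩
  · simp
  choose B hB hBi using hi
  have hsub : F ⊆ A.biUnion (fun a => (B a).biUnion (fun b =>
      if a = b then ∅ else (powersetCard k univ).filter (fun S => ({a, b} : Finset (Fin n)) ⊆ S))) := by
    intro S hS
    obtain ⟨a, haS, haA⟩ := not_disjoint_iff.1 (hI S hS A hA)
    obtain ⟨b, hbS, hbB⟩ := not_disjoint_iff.1 (hI S hS (B a) (hB a))
    have hab : a ≠ b := by
      rintro rfl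
      exact hBi a hbB
    simp only [mem_biUnion]
    refine ⟨a, haA, b, hbB, ?_⟩
    rw [if_neg hab]
    simp [mem_powersetCard, hF S hS, insert_subset_iff, haS, hbS]
  refine (card_le_card hsub).trans ?_
  have := card_biUnion_le_card_mul A (fun a => (B a).biUnion (fun b =>
      if a = b then ∅ else (powersetCard k univ).filter (fun S => ({a, b} : Finset (Fin n)) ⊆ S)))
      (k * (n - 2).choose (k - 2)) (by
    intro a ha
    have := card_biUnion_le_card_mul (B a) (fun b =>
      if a = b then ∅ else (powersetCard k univ).filter (fun S => ({a, b} : Finset (Fin n)) ⊆ S))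
      ((n - 2).choose (k - 2)) (by
        intro b hb
        split_ifs with hab
        · simp
        · have h := card_supersets_le n k {a, b}
          rwa [card_pair hab] at h)
    rwa [hF _ (hB a)] at this)
  rw [hF A hA] at this
  refine this.trans (le_of_eq ?_)
  ring


/-- For `k ≥ 2`, `0 < β < 1`, and `n > k³(k-β)/(1-β)`: every `(n-2k+1)`-coloring of
the `(n,k)`-Kneser graph has at least `(n/k)·β` star-shaped color classes. -/
theorem many_starShaped_classes (n k : ℕ) (hk : 2 ≤ k) (β : ℝ)
    (hβ0 : 0 < β) (hβ1 : β < 1)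
    (hn : (k : ℝ) ^ 3 * ((k : ℝ) - β) / (1 - β) < (n : ℝ))
    (c : Finset (Fin n) → ℕ)
    (hrange : ∀ S : Finset (Fin n), S.card = k → c S ∈ Finset.Icc 1 (n - 2 * k + 1))
    (hproper : ∀ S T : Finset (Fin n), S.card = k → T.card = k →
      Disjoint S T → c S ≠ c T) :
    ((n : ℝ) / (k : ℝ)) * β ≤
      (((Finset.Icc 1 (n - 2 * k + 1)).filter (fun ℓ => ∃ i : Fin n,
        ∀ S : Finset (Fin n), S.card = k → c S = ℓ → i ∈ S)).card : ℝ) := by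
  set m := n - 2 * k + 1 with hm
  set G := (Finset.Icc 1 m).filter (fun ℓ => ∃ i : Fin n,
        ∀ S : Finset (Fin n), S.card = k → c S = ℓ → i ∈ S) with hG
  have hkR : (2 : ℝ) ≤ k := by exact_mod_cast hk
  have hb : 0 < 1 - β := by linarith
  rw [div_lt_iff₀ hb] at hn
  have hn3 : (k : ℝ) ^ 3 * k < n := by
    have h1 : (k : ℝ) * (1 - β) ≤ k - β := by nlinarith
    have h2 : (k : ℝ) ^ 3 * (k * (1 - β)) ≤ (k : ℝ) ^ 3 * (k - β) := by gcongr
    have h3 : (k : ℝ) ^ 3 * k * (1 - β) < n * (1 - β) := by linarith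
    exact lt_of_mul_lt_mul_right h3 hb.le
  have hn4 : k ^ 3 * k < n := by exact_mod_cast hn3
  have h2k : 2 * k ≤ n := by
    have : 2 * k ≤ k ^ 3 * k := by
      apply Nat.mul_le_mul_right
      nlinarith [Nat.mul_le_mul hk hk]
    omega
  -- counting
  have hcount : n.choose k ≤ G.card * (n - 1).choose (k - 1) +
      (m - G.card) * (k ^ 2 * (n - 2).choose (k - 2)) := by
    have h1 : (Finset.powersetCard k (Finset.univ : Finset (Fin n))).card = n.choose k := by simp
    rw [← h1, Finset.card_eq_sum_card_fiberwise (f := c) (t := Finset.Icc 1 m)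
      (fun S hS => hrange S (Finset.mem_powersetCard.1 hS).2),
      ← Finset.sum_filter_add_sum_filter_not (Finset.Icc 1 m) (fun ℓ => ∃ i : Fin n,
        ∀ S : Finset (Fin n), S.card = k → c S = ℓ → i ∈ S)]
    apply Nat.add_le_add
    · rw [← smul_eq_mul]
      apply Finset.sum_le_card_nsmul
      intro ℓ hℓ
      obtain ⟨i, hi⟩ := (Finset.mem_filter.1 hℓ).2
      refine star_card_le n k _ ?_ i ?_
      · intro S hS
        exact (Finset.mem_powersetCard.1 (Finset.mem_filter.1 hS).1).2
      · intro S hS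
        exact hi S (Finset.mem_powersetCard.1 (Finset.mem_filter.1 hS).1).2
          (Finset.mem_filter.1 hS).2
    · have hc : m - G.card = ((Finset.Icc 1 m).filter (fun ℓ => ¬ ∃ i : Fin n,
          ∀ S : Finset (Fin n), S.card = k → c S = ℓ → i ∈ S)).card := by
        have := Finset.card_filter_add_card_filter_not (s := Finset.Icc 1 m) (fun ℓ => ∃ i : Fin n,
          ∀ S : Finset (Fin n), S.card = k → c S = ℓ → i ∈ S)
        rw [Nat.card_Icc, ← hG, Nat.add_sub_cancel] at this
        have h' := Nat.eq_sub_of_add_eq' this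
        rw [← h']
      rw [hc, ← smul_eq_mul]
      apply Finset.sum_le_card_nsmul
      intro ℓ hℓ
      have hns := (Finset.mem_filter.1 hℓ).2
      push Not at hns
      refine nonstar_card_le n k _ ?_ ?_ ?_
      · intro S hS
        exact (Finset.mem_powersetCard.1 (Finset.mem_filter.1 hS).1).2
      · intro S hS T hT hd
        simp only [Finset.mem_filter, Finset.mem_powersetCard] at hS hT
        exact hproper S T hS.1.2 hT.1.2 hd (hS.2.trans hT.2.symm)
      · intro i
        obtain ⟨S, h1, h2, h3⟩ := hns i
        exact ⟨S, by simp [Finset.mem_powersetCard, h1, h2], h3⟩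
  have hGm : G.card ≤ m := by
    have := Finset.card_filter_le (Finset.Icc 1 m) (fun ℓ => ∃ i : Fin n,
        ∀ S : Finset (Fin n), S.card = k → c S = ℓ → i ∈ S)
    rwa [Nat.card_Icc, Nat.add_sub_cancel] at this
  have hmR : (m : ℝ) = n - 2 * k + 1 := by
    rw [hm]; push_cast [Nat.cast_sub h2k]; ring
  generalize G.card = a at *
  clear_value m
  obtain ⟨k', rfl⟩ : ∃ k', k = k' + 2 := ⟨k - 2, by omega⟩
  obtain ⟨n', rfl⟩ : ∃ n', n = n' + 2 := ⟨n - 2, by omega⟩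
  have e1 := Nat.add_one_mul_choose_eq (n' + 1) (k' + 1)
  have e2 := Nat.add_one_mul_choose_eq n' k'
  have hPpos : 0 < (n' + 1).choose (k' + 1) := Nat.choose_pos (by omega)
  simp only [Nat.add_sub_cancel, show n' + 2 - 1 = n' + 1 from rfl,
    show k' + 2 - 1 = k' + 1 from rfl] at hcount
  have hcR : (((n' + 2).choose (k' + 2) : ℕ) : ℝ) ≤ a * ((n' + 1).choose (k' + 1) : ℕ) +
      ((m : ℝ) - a) * (((k' + 2 : ℕ) : ℝ) ^ 2 * (n'.choose k' : ℕ)) := by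
    rw [← Nat.cast_sub hGm]; exact_mod_cast hcount
  have e1R : ((n' + 2 : ℕ) : ℝ) * ((n' + 1).choose (k' + 1) : ℕ) =
      ((n' + 2).choose (k' + 2) : ℕ) * ((k' + 2 : ℕ) : ℝ) := by exact_mod_cast e1
  have e2R : (((n' + 2 : ℕ) : ℝ) - 1) * (n'.choose k' : ℕ) =
      ((n' + 1).choose (k' + 1) : ℕ) * (((k' + 2 : ℕ) : ℝ) - 1) := by
    have : ((n' + 1 : ℕ) : ℝ) * (n'.choose k' : ℕ) =
      ((n' + 1).choose (k' + 1) : ℕ) * ((k' + 1 : ℕ) : ℝ) := by exact_mod_cast e2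
    push_cast at this ⊢
    linarith
  have hP : (0 : ℝ) < ((n' + 1).choose (k' + 1) : ℕ) := by exact_mod_cast hPpos
  clear hcount e1 e2 hPpos hn4 hrange hproper hG
  generalize (((n' + 1).choose (k' + 1) : ℕ) : ℝ) = P at *
  generalize (((n' + 2).choose (k' + 2) : ℕ) : ℝ) = N at *
  generalize ((n'.choose k' : ℕ) : ℝ) = Q at *
  generalize ((n' + 2 : ℕ) : ℝ) = x at *
  generalize ((k' + 2 : ℕ) : ℝ) = y at *
  generalize (a : ℝ) = A at *
  generalize (m : ℝ) = M at *
  subst hmR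
  have hy : 0 < y := by linarith
  have hx8 : y ^ 3 ≤ y ^ 3 * y := by nlinarith [pow_pos hy 3]
  have hx1 : 1 < x := by nlinarith [pow_pos hy 3, pow_pos hy 2]
  by_contra hlt
  push Not at hlt
  rw [div_mul_eq_mul_div, lt_div_iff₀ hy] at hlt
  have k1 : x * (x - 1) ≤ A * y * (x - 1) + (y * (x - 2 * y + 1) - A * y) * (y ^ 2 * (y - 1)) := by
    have h1 : N * (y * (x - 1)) ≤ (A * P + (x - 2 * y + 1 - A) * (y ^ 2 * Q)) * (y * (x - 1)) :=
      mul_le_mul_of_nonneg_right hcR (by nlinarith)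
    have h2 : N * (y * (x - 1)) = x * (x - 1) * P := by
      linear_combination (-(x - 1)) * e1R
    have h3 : (A * P + (x - 2 * y + 1 - A) * (y ^ 2 * Q)) * (y * (x - 1)) =
      (A * y * (x - 1) + (y * (x - 2 * y + 1) - A * y) * (y ^ 2 * (y - 1))) * P := by
      linear_combination ((x - 2 * y + 1 - A) * y ^ 2 * y) * e2R
    rw [h2, h3] at h1
    exact le_of_mul_le_mul_right h1 hP
  have hco : 0 < x - 1 - y ^ 2 * (y - 1) := by nlinarith [pow_pos hy 2]
  have k2 : A * y * (x - 1 - y ^ 2 * (y - 1)) < x * β * (x - 1 - y ^ 2 * (y - 1)) :=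
    mul_lt_mul_of_pos_right hlt hco
  have k3 : x * (x - 1) * (1 - β) < y ^ 2 * (y - 1) * (y * x - x * β - y * (2 * y - 1)) := by
    linarith
  have k4 : y ^ 2 * (y - 1) * (y * x - x * β - y * (2 * y - 1)) ≤
      y ^ 2 * (y - 1) * ((y - β) * (x - 1)) := by
    apply mul_le_mul_of_nonneg_left
    · nlinarith
    · exact mul_nonneg (by positivity) (by linarith)
  have k5 : y ^ 2 * (y - 1) * ((y - β) * (x - 1)) ≤ y ^ 3 * (y - β) * (x - 1) := by
    have : 0 ≤ y ^ 2 * ((y - β) * (x - 1)) :=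
      mul_nonneg (by positivity) (mul_nonneg (by linarith) (by linarith))
    linarith
  have k6 := mul_lt_mul_of_pos_right hn (show 0 < x - 1 by linarith)
  linarith
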